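/- Let A and B be complex unital Banach algebras with A semisimple, and let T : A → B be a surjective additive map that preserves the spectral radius, i.e. r(Tx) = r(x) for all x ∈ A. Then T is continuous. -/

import Mathlib

open Filter Topology Polynomial
open scoped NNReal ENNReal

section SpectralRadius

variable {A : Type*} [NormedRing A] [NormedAlgebra ℂ A] [CompleteSpace A]

theorem eventually_norm_pow_lt_of_spectralRadius_lt {x : A} {C : ℝ≥0}
    (h : spectralRadius ℂ x < C) : ∀ᶠ n : ℕ in atTop, ‖x ^ n‖ < (C : ℝ) ^ n := by
  have ht := spectrum.pow_nnnorm_pow_one_div_tendsto_nhds_spectralRadius x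
  filter_upwards [ht.eventually_lt_const h, eventually_gt_atTop 0] with n hn hn0
  have hn' : (0 : ℝ) < n := by exact_mod_cast hn0
  rw [one_div, ENNReal.rpow_inv_lt_iff hn', ENNReal.rpow_natCast] at hn
  exact_mod_cast hn

theorem spectralRadius_le_coe_nnnorm (x : A) : spectralRadius ℂ x ≤ ‖x‖₊ := by
  refine le_of_tendsto (spectrum.pow_nnnorm_pow_one_div_tendsto_nhds_spectralRadius x) ?_
  filter_upwards [eventually_gt_atTop 0] with n hn0
  have hn' : (0 : ℝ) < n := by exact_mod_cast hn0
  rw [one_div, ENNReal.rpow_inv_le_iff hn', ENNReal.rpow_natCast]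
  exact_mod_cast nnnorm_pow_le' x hn0

theorem spectralRadius_ne_top (x : A) : spectralRadius ℂ x ≠ ∞ :=
  ne_top_of_le_ne_top ENNReal.coe_ne_top (spectralRadius_le_coe_nnnorm x)

theorem spectralRadius_pow_le_nnnorm_pow (x : A) {n : ℕ} (hn : n ≠ 0) :
    spectralRadius ℂ x ^ n ≤ ‖x ^ n‖₊ :=
  (spectrum.spectralRadius_pow_le x n hn).trans (spectralRadius_le_coe_nnnorm _)

theorem spectralRadius_toReal_pow_le_norm_pow (x : A) {n : ℕ} (hn : n ≠ 0) :
    (spectralRadius ℂ x).toReal ^ n ≤ ‖x ^ n‖ := by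
  have := ENNReal.toReal_mono ENNReal.coe_ne_top (spectralRadius_pow_le_nnnorm_pow x hn)
  simpa using this

theorem le_spectralRadius_of_frequently {x : A} {C : ℝ≥0}
    (h : ∃ᶠ n : ℕ in atTop, (C : ℝ) ^ n ≤ ‖x ^ n‖) : C ≤ spectralRadius ℂ x := by
  by_contra! hlt
  refine h ?_
  filter_upwards [eventually_norm_pow_lt_of_spectralRadius_lt hlt] with n hn
  exact not_le.2 hn

theorem isOpen_setOf_spectralRadius_lt (C : ℝ≥0) :
    IsOpen {x : A | spectralRadius ℂ x < C} := by
  rw [isOpen_iff_mem_nhds]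
  intro x hx
  obtain ⟨n, hn, hn0⟩ :=
    ((eventually_norm_pow_lt_of_spectralRadius_lt hx).and (eventually_ne_atTop 0)).exists
  have hc : Continuous fun y : A => ‖y ^ n‖ := by fun_prop
  filter_upwards [hc.continuousAt.eventually_lt_const hn] with y hy
  have h1 : spectralRadius ℂ y ^ n < (C : ℝ≥0∞) ^ n := by
    refine (spectralRadius_pow_le_nnnorm_pow y hn0).trans_lt ?_
    exact_mod_cast hy
  exact lt_of_not_ge fun hge => h1.not_ge (pow_le_pow_left' hge n)

theorem le_spectralRadius_of_tendsto {u : ℕ → A} {x : A} {C : ℝ≥0}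
    (hu : Tendsto u atTop (𝓝 x)) (h : ∃ᶠ n in atTop, C ≤ spectralRadius ℂ (u n)) :
    C ≤ spectralRadius ℂ x := by
  by_contra! hlt
  refine h ?_
  filter_upwards [hu.eventually ((isOpen_setOf_spectralRadius_lt C).mem_nhds hlt)] with n hn
  exact not_le.2 hn

end SpectralRadius

theorem norm_sub_eq_norm_reflection {R : ℝ} (hR : 0 < R) (α z : ℂ) (hz : ‖z‖ = R) :
    ‖(R : ℂ) - starRingEnd ℂ α * z / R‖ = ‖z - α‖ := by
  have hR' : (R : ℂ) ≠ 0 := by exact_mod_cast hR.ne'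
  have hzz : starRingEnd ℂ z * z = (R : ℂ) ^ 2 := by
    rw [Complex.conj_mul', hz]
  have : (R : ℂ) - starRingEnd ℂ α * z / R = starRingEnd ℂ (z - α) * (z / R) := by
    rw [map_sub]
    field_simp
    linear_combination -hzz
  rw [this, norm_mul, RCLike.norm_conj, norm_div, hz, Complex.norm_real, Real.norm_of_nonneg hR.le,
    div_self hR.ne', mul_one]

theorem exists_reflection_linear {R : ℝ} (hR : 0 < R) (α : ℂ) :
    ∃ Q : ℂ → ℂ, Differentiable ℂ Q ∧ (∀ z, ‖z‖ = R → ‖Q z‖ = ‖z - α‖) ∧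
      ∀ a : ℂ, ‖a‖ ≤ 1 → ‖a - α‖ ≤ (1 + 1 / R) * ‖Q 0‖ := by
  have key : ∀ M : ℝ, R ≤ M → ‖α‖ ≤ M → ∀ a : ℂ, ‖a‖ ≤ 1 → ‖a - α‖ ≤ (1 + 1 / R) * M := by
    intro M h1 h2 a ha
    have : 1 ≤ 1 / R * M := by rw [one_div_mul_eq_div, one_le_div hR]; exact h1
    linarith [norm_sub_le a α]
  rcases le_total R ‖α‖ with h | h
  · refine ⟨fun z => z - α, by fun_prop, fun _ _ => rfl, fun a ha => ?_⟩
    simpa using key _ h le_rfl a ha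
  · refine ⟨fun z => R - starRingEnd ℂ α * z / R, by fun_prop,
      fun z hz => norm_sub_eq_norm_reflection hR α z hz, fun a ha => ?_⟩
    simpa [abs_of_pos hR] using key _ le_rfl h a ha

/-- Reflecting the roots of a polynomial out of a disc gives an entire function with the same
modulus on the boundary circle, whose value at the centre controls the polynomial near there. -/
theorem exists_reflection {R : ℝ} (hR : 0 < R) (P : ℂ[X]) :
    ∃ Q : ℂ → ℂ, Differentiable ℂ Q ∧ (∀ z, ‖z‖ = R → ‖Q z‖ = ‖P.eval z‖) ∧
      ∀ a : ℂ, ‖a‖ ≤ 1 → ‖P.eval a‖ ≤ (1 + 1 / R) ^ P.natDegree * ‖Q 0‖ := by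
  have main : ∀ s : Multiset ℂ, ∃ Q : ℂ → ℂ, Differentiable ℂ Q ∧
      (∀ z, ‖z‖ = R → ‖Q z‖ = ‖(s.map (z - ·)).prod‖) ∧
      ∀ a : ℂ, ‖a‖ ≤ 1 → ‖(s.map (a - ·)).prod‖ ≤ (1 + 1 / R) ^ s.card * ‖Q 0‖ := by
    intro s
    induction s using Multiset.induction with
    | empty => exact ⟨fun _ => 1, by fun_prop, by simp, by simp⟩
    | cons α s ih =>
      obtain ⟨Q, hQ, hQ1, hQ2⟩ := ih
      obtain ⟨L, hL, hL1, hL2⟩ := exists_reflection_linear hR α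
      refine ⟨fun z => L z * Q z, hL.mul hQ, fun z hz => ?_, fun a ha => ?_⟩
      · simp [hL1 z hz, hQ1 z hz]
      · simp only [Multiset.map_cons, Multiset.prod_cons, norm_mul, Multiset.card_cons]
        calc _ ≤ ((1 + 1 / R) * ‖L 0‖) * ((1 + 1 / R) ^ s.card * ‖Q 0‖) :=
              mul_le_mul (hL2 a ha) (hQ2 a ha) (norm_nonneg _) (by positivity)
          _ = _ := by ring
  obtain ⟨Q, hQ, hQ1, hQ2⟩ := main P.roots
  have hP : ∀ z, P.eval z = P.leadingCoeff * (P.roots.map (z - ·)).prod := by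
    intro z
    conv_lhs => rw [(IsAlgClosed.splits P).eq_prod_roots]
    simp [eval_multiset_prod, Multiset.map_map]
  refine ⟨fun z => P.leadingCoeff * Q z, by fun_prop, fun z hz => ?_, fun a ha => ?_⟩
  · rw [hP, norm_mul, norm_mul, hQ1 z hz]
  · rw [hP, norm_mul, norm_mul, mul_left_comm]
    gcongr
    refine (hQ2 a ha).trans ?_
    gcongr
    · have : 0 < 1 / R := by positivity
      linarith
    · exact P.card_roots'

theorem exists_norm_eq_prod_eval_le {ι : Type*} [Fintype ι] {R : ℝ} (hR : 0 < R) {N : ℕ}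
    (f : ι → ℂ[X]) (hf : ∀ i, (f i).natDegree ≤ N) (a : ι → ℂ) (ha : ∀ i, ‖a i‖ ≤ 1) :
    ∃ z : ℂ, ‖z‖ = R ∧ ∏ i, ‖(f i).eval (a i)‖ ≤
      ((1 + 1 / R) ^ N) ^ Fintype.card ι * ∏ i, ‖(f i).eval z‖ := by
  choose Q hQ hQ1 hQ2 using fun i => exists_reflection hR (f i)
  have hd : Differentiable ℂ fun z => ∏ i, Q i z := by fun_prop
  obtain ⟨z, hz, hmax⟩ := Complex.exists_mem_frontier_isMaxOn_norm (Metric.isBounded_ball)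
    (Metric.nonempty_ball.2 hR) (hd.diffContOnCl (s := Metric.ball (0 : ℂ) R))
  rw [frontier_ball _ hR.ne', mem_sphere_zero_iff_norm] at hz
  refine ⟨z, hz, ?_⟩
  have h0 := hmax (subset_closure (Metric.mem_ball_self hR))
  simp only [Function.comp_apply, Set.mem_ofPred_eq, norm_prod] at h0
  have h1 : (1 : ℝ) ≤ 1 + 1 / R := by
    have : 0 < 1 / R := by positivity
    linarith
  calc ∏ i, ‖(f i).eval (a i)‖ ≤ ∏ i, ((1 + 1 / R) ^ N * ‖Q i 0‖) := by
        refine Finset.prod_le_prod (fun _ _ => norm_nonneg _) fun i _ => ?_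
        refine (hQ2 i (a i) (ha i)).trans ?_
        gcongr
        exact hf i
    _ = ((1 + 1 / R) ^ N) ^ Fintype.card ι * ∏ i, ‖Q i 0‖ := by
        rw [Finset.prod_mul_distrib, Finset.prod_const, Finset.card_univ]
    _ ≤ ((1 + 1 / R) ^ N) ^ Fintype.card ι * ∏ i, ‖Q i z‖ := by gcongr
    _ = _ := by simp only [hQ1 _ z hz]

theorem exists_polynomial_eval_eq_functional_pow {B : Type*} [Ring B] [Algebra ℂ B]
    (φ : B →ₗ[ℂ] ℂ) (u v : B) (N : ℕ) :
    ∃ P : ℂ[X], P.natDegree ≤ N ∧ ∀ z : ℂ, P.eval z = φ ((u + z • v) ^ N) := by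
  let q : B[X] := (C u + C v * X) ^ N
  have hq : q.natDegree ≤ N := by
    refine natDegree_pow_le.trans ?_
    have : (C u + C v * X : B[X]).natDegree ≤ 1 := by
      compute_degree
    nlinarith
  refine ⟨∑ k ∈ Finset.range (N + 1), monomial k (φ (q.coeff k)), ?_, fun z => ?_⟩
  · refine natDegree_sum_le_of_forall_le _ _ fun k hk => (natDegree_monomial_le _).trans ?_
    exact Nat.lt_succ_iff.1 (Finset.mem_range.1 hk)
  · have h1 : (u + z • v) ^ N =
        eval₂RingHom' (RingHom.id B) (algebraMap ℂ B z)
          (fun b => (Algebra.commutes z b).symm) q := by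
      rw [map_pow]
      simp [eval₂RingHom', ← Algebra.commutes, Algebra.smul_def]
    have h2 : (u + z • v) ^ N = ∑ k ∈ Finset.range (N + 1), z ^ k • q.coeff k := by
      rw [h1]
      change eval₂ _ _ _ = _
      rw [eval₂_eq_sum_range' _ (Nat.lt_succ_of_le hq)]
      refine Finset.sum_congr rfl fun k _ => ?_
      rw [RingHom.id_apply, ← map_pow, ← Algebra.commutes, Algebra.smul_def]
    rw [h2, map_sum, eval_finsetSum]
    refine Finset.sum_congr rfl fun k _ => ?_
    rw [eval_monomial, map_smul, smul_eq_mul, mul_comm]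

theorem le_of_prod_le_of_le_one {ι : Type*} [Fintype ι] {x : ι → ℝ} {m : ℝ}
    (h0 : ∀ i, 0 ≤ x i) (h1 : ∀ i, x i ≤ 1) (hm : m ≤ ∏ i, x i) (i : ι) : m ≤ x i := by
  classical
  refine hm.trans ?_
  rw [← Finset.mul_prod_erase _ _ (Finset.mem_univ i)]
  exact mul_le_of_le_one_right (h0 i) (Finset.prod_le_one (fun j _ => h0 j) fun j _ => h1 j)

/-- If the `N`-th powers of the points `p i` are nearly as large as their local maximum, then on
every circle some `z` keeps all the `N`-th powers of `p i + (z - a i) • c` large. -/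
theorem exists_norm_eq_forall_le_norm_pow {B : Type*} [NormedRing B]
    [NormedAlgebra ℂ B] {ι : Type*} [Fintype ι] {R : ℝ} (hR : 0 < R) {N : ℕ}
    (p : ι → B) (a : ι → ℂ) (ha : ∀ i, ‖a i‖ ≤ 1) (c : B) {ρ : ι → ℝ} (hρ : ∀ i, 0 < ρ i)
    (hlow : ∀ i, ρ i ^ N ≤ ‖p i ^ N‖)
    (hup : ∀ i, ∀ z : ℂ, ‖z‖ = R → ‖(p i + (z - a i) • c) ^ N‖ ≤ ((1 + 1 / R) * ρ i) ^ N) :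
    ∃ z : ℂ, ‖z‖ = R ∧ ∀ i, ρ i ^ N ≤
      ((1 + 1 / R) ^ (2 * Fintype.card ι)) ^ N * ‖(p i + (z - a i) • c) ^ N‖ := by
  choose φ hφ1 hφ2 using fun i => exists_dual_vector'' ℂ (p i ^ N)
  choose f hf1 hf2 using fun i =>
    exists_polynomial_eval_eq_functional_pow (φ i : B →ₗ[ℂ] ℂ) (p i - a i • c) c N
  obtain ⟨z, hz, hprod⟩ := exists_norm_eq_prod_eval_le hR f hf1 a ha
  refine ⟨z, hz, fun i => ?_⟩
  set κ : ℝ := 1 + 1 / R with hκ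
  have hκ1 : 1 ≤ κ := by
    have : 0 < 1 / R := by positivity
    linarith
  have hκ0 : 0 < κ := by linarith
  have hfa : ∀ j, ρ j ^ N ≤ ‖(f j).eval (a j)‖ := by
    intro j
    rw [hf2, sub_add_cancel]
    have : (φ j : B →ₗ[ℂ] ℂ) (p j ^ N) = (‖p j ^ N‖ : ℂ) := hφ2 j
    rw [this]
    simpa using hlow j
  have hfz : ∀ j, ‖(f j).eval z‖ ≤ ‖(p j + (z - a j) • c) ^ N‖ := by
    intro j
    have e : p j - a j • c + z • c = p j + (z - a j) • c := by rw [sub_smul]; abel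
    rw [hf2, e]
    exact ((φ j).le_opNorm _).trans (mul_le_of_le_one_left (norm_nonneg _) (hφ1 j))
  set m := Fintype.card ι
  have hpos : ∀ j, 0 < (κ * ρ j) ^ N := fun j => pow_pos (mul_pos hκ0 (hρ j)) N
  have hx := le_of_prod_le_of_le_one (x := fun j => ‖(f j).eval z‖ / (κ * ρ j) ^ N)
    (m := ((κ ^ (2 * m)) ^ N)⁻¹) (fun j => by have := hpos j; positivity)
    (fun j => (div_le_one (hpos j)).2 ((hfz j).trans (hup j z hz))) (by
      rw [Finset.prod_div_distrib, le_div_iff₀ (Finset.prod_pos fun j _ => hpos j),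
        inv_mul_le_iff₀ (by positivity)]
      have e1 : ∏ j, (κ * ρ j) ^ N = (κ ^ N) ^ m * ∏ j, ρ j ^ N := by
        simp only [mul_pow, Finset.prod_mul_distrib, Finset.prod_const, Finset.card_univ, m]
      rw [e1]
      have h1 : ∏ j, ρ j ^ N ≤ ∏ j, ‖(f j).eval (a j)‖ :=
        Finset.prod_le_prod (fun j _ => (pow_pos (hρ j) N).le) fun j _ => hfa j
      calc (κ ^ N) ^ m * ∏ j, ρ j ^ N
          ≤ (κ ^ N) ^ m * ((κ ^ N) ^ m * ∏ j, ‖(f j).eval z‖) := by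
            gcongr
            exact h1.trans hprod
        _ = (κ ^ (2 * m)) ^ N * ∏ j, ‖(f j).eval z‖ := by ring) i
  rw [le_div_iff₀ (hpos i), inv_mul_le_iff₀ (by positivity)] at hx
  calc ρ i ^ N ≤ (κ * ρ i) ^ N := by
        gcongr
        · exact (hρ i).le
        · exact le_mul_of_one_le_left (hρ i).le hκ1
    _ ≤ _ := hx
    _ ≤ _ := by gcongr; exact hfz i

section Perturbation

variable {B : Type*} [NormedRing B] [NormedAlgebra ℂ B] [CompleteSpace B]

theorem exists_norm_pow_two_pow_lt_near {x : B} {U : ℝ≥0} (h : spectralRadius ℂ x < U) :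
    ∀ᶠ k : ℕ in atTop, ∀ᶠ y in 𝓝 x, ∀ l ≥ k, ‖y ^ 2 ^ l‖ ≤ (U : ℝ) ^ 2 ^ l := by
  have ht : Tendsto (fun k : ℕ => 2 ^ k) atTop atTop := tendsto_pow_atTop_atTop_of_one_lt one_lt_two
  filter_upwards [ht.eventually (eventually_norm_pow_lt_of_spectralRadius_lt h)] with k hk
  have hc : Continuous fun y : B => ‖y ^ 2 ^ k‖ := by fun_prop
  filter_upwards [hc.continuousAt.eventually_lt_const hk] with y hy l hl
  induction l, hl using Nat.le_induction with
  | base => exact hy.le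
  | succ l _ ih =>
    rw [pow_succ 2 l, pow_mul, pow_mul]
    exact (norm_pow_le' _ two_pos).trans (pow_le_pow_left₀ (norm_nonneg _) ih 2)

theorem exists_one_lt_pow_mul_le {ι : Type*} [Finite ι] {C : ℝ} {ρ : ι → ℝ}
    (h : ∀ i, C < ρ i) (e : ℕ) : ∃ R : ℝ, 0 < R ∧ ∀ i, (1 + 1 / R) ^ e * C ≤ ρ i := by
  have ht : Tendsto (fun R : ℝ => (1 + 1 / R) ^ e * C) atTop (𝓝 ((1 + 0) ^ e * C)) :=
    (((tendsto_const_nhds.div_atTop tendsto_id).const_add 1).pow e).mul_const C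
  have := (eventually_gt_atTop (0 : ℝ)).and
    (eventually_all.2 fun i => ht.eventually_le_const (by simpa using h i))
  exact this.exists

/-- Finitely many points of spectral radius larger than `C`, the `i`-th one being moved along the
line `z ↦ p i + (z - a i) • c` with `c` small, can be moved simultaneously by a common small `z • c`
without the spectral radii dropping below `C`. -/
theorem exists_common_translate_le_spectralRadius {ι : Type*} [Fintype ι] (p : ι → B) (a : ι → ℂ)
    (ha : ∀ i, ‖a i‖ ≤ 1) {C : ℝ≥0} (hC : ∀ i, C < spectralRadius ℂ (p i)) {ε : ℝ} (hε : 0 < ε) :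
    ∃ δ > 0, ∀ c : B, ‖c‖ < δ → ∃ z : ℂ, ‖z • c‖ ≤ ε ∧
      ∀ i, C ≤ spectralRadius ℂ (p i + (z - a i) • c) := by
  set ρ : ι → ℝ≥0 := fun i => (spectralRadius ℂ (p i)).toNNReal with hρdef
  have hρ : ∀ i, (ρ i : ℝ≥0∞) = spectralRadius ℂ (p i) :=
    fun i => ENNReal.coe_toNNReal (spectralRadius_ne_top _)
  have hCρ : ∀ i, (C : ℝ) < ρ i := by
    intro i
    have := hC i
    rw [← hρ i] at this
    exact_mod_cast this
  have hρ0 : ∀ i, (0 : ℝ) < ρ i := fun i => C.coe_nonneg.trans_lt (hCρ i)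
  obtain ⟨R, hR, hRC⟩ := exists_one_lt_pow_mul_le hCρ (2 * Fintype.card ι)
  let κ : ℝ≥0 := ⟨1 + 1 / R, by positivity⟩
  have hκ : (κ : ℝ) = 1 + 1 / R := rfl
  have hκ1 : 1 < κ := by
    rw [← NNReal.coe_lt_coe, hκ]
    have : 0 < 1 / R := by positivity
    simpa using hR
  have hU : ∀ i, spectralRadius ℂ (p i) < (κ * ρ i : ℝ≥0) := by
    intro i
    rw [← hρ i, ENNReal.coe_lt_coe]
    exact lt_mul_of_one_lt_left (by exact_mod_cast hρ0 i) hκ1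
  obtain ⟨k₀, hk₀⟩ := (eventually_all.2 fun i => exists_norm_pow_two_pow_lt_near (hU i)).exists
  choose η hη0 hη using fun i => Metric.eventually_nhds_iff.1 (hk₀ i)
  obtain ⟨η', hη'0, hη'⟩ : ∃ η' > 0, ∀ i, η' ≤ η i := by
    have : ∀ᶠ t in 𝓝[>] (0 : ℝ), ∀ i, t ≤ η i := eventually_all.2 fun i =>
      (eventually_le_nhds (hη0 i)).filter_mono nhdsWithin_le_nhds
    exact (eventually_mem_nhdsWithin.and this).exists
  refine ⟨min ε η' / (R + 1), by positivity, fun c hc => ?_⟩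
  rw [lt_div_iff₀ (by positivity)] at hc
  have hcε : R * ‖c‖ ≤ ε := by nlinarith [min_le_left ε η', norm_nonneg c]
  have hcη : (R + 1) * ‖c‖ < η' := by nlinarith [min_le_right ε η']
  let Λ : ℕ → Set ℂ := fun k => {z | ‖z‖ = R ∧
    ∀ i, (C : ℝ) ^ 2 ^ (k₀ + k) ≤ ‖(p i + (z - a i) • c) ^ 2 ^ (k₀ + k)‖}
  have hclosed : ∀ k, IsClosed (Λ k) := by
    intro k
    have hΛ : Λ k = {z | ‖z‖ = R} ∩
        ⋂ i, {z | (C : ℝ) ^ 2 ^ (k₀ + k) ≤ ‖(p i + (z - a i) • c) ^ 2 ^ (k₀ + k)‖} := by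
      ext z
      simp [Λ]
    rw [hΛ]
    exact (isClosed_eq continuous_norm continuous_const).inter
      (isClosed_iInter fun i => isClosed_le continuous_const (by fun_prop))
  have hsub : ∀ k, Λ (k + 1) ⊆ Λ k := by
    rintro k z ⟨hz, h⟩
    refine ⟨hz, fun i => ?_⟩
    have h' := h i
    rw [← add_assoc, pow_succ 2, pow_mul, pow_mul] at h'
    exact le_of_sq_le_sq (h'.trans (norm_pow_le' _ two_pos)) (norm_nonneg _)
  have hne : ∀ k, (Λ k).Nonempty := by
    intro k
    obtain ⟨z, hz, h⟩ := exists_norm_eq_forall_le_norm_pow hR (N := 2 ^ (k₀ + k)) p a ha c hρ0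
      (fun i => spectralRadius_toReal_pow_le_norm_pow (p i) (by positivity)) (by
        intro i z hz
        have hd : dist (p i + (z - a i) • c) (p i) < η i := by
          rw [dist_self_add_left, norm_smul]
          refine (mul_le_mul_of_nonneg_right ((norm_sub_le _ _).trans ?_)
            (norm_nonneg c)).trans_lt (hcη.trans_le (hη' i))
          rw [hz]
          linarith [ha i]
        exact_mod_cast hη i hd (k₀ + k) (Nat.le_add_right _ _))
    refine ⟨z, hz, fun i => ?_⟩
    have h1 := pow_le_pow_left₀ (by positivity) (hRC i) (2 ^ (k₀ + k))
    rw [mul_pow] at h1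
    exact le_of_mul_le_mul_left (h1.trans (h i)) (by positivity)
  have hcomp : IsCompact (Λ 0) :=
    (isCompact_sphere (0 : ℂ) R).of_isClosed_subset (hclosed 0) fun z hz => by simpa using hz.1
  obtain ⟨z, hz⟩ :=
    IsCompact.nonempty_iInter_of_sequence_nonempty_isCompact_isClosed Λ hsub hne hcomp hclosed
  rw [Set.mem_iInter] at hz
  refine ⟨z, by rw [norm_smul, (hz 0).1]; exact hcε, fun i => le_spectralRadius_of_frequently ?_⟩
  have ht : Tendsto (fun k : ℕ => 2 ^ (k₀ + k)) atTop atTop :=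
    (tendsto_pow_atTop_atTop_of_one_lt one_lt_two).comp (tendsto_add_atTop_nat k₀ |>.congr
      fun k => add_comm k k₀)
  exact ht.frequently (Frequently.of_forall fun k => (hz k).2 i)

/-- If `u n → x` and the spectral radius of `x` exceeds `C`, then arbitrarily small translates `w`
satisfy `C ≤ r (u n + w)` for infinitely many `n`, although the spectral radius need not be
continuous at `x`. -/
theorem exists_translate_frequently_le_spectralRadius {u : ℕ → B} {x : B}
    (hu : Tendsto u atTop (𝓝 x)) {C : ℝ≥0} (hC : C < spectralRadius ℂ x) {ε : ℝ} (hε : 0 < ε) :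
    ∃ w : B, ‖w‖ ≤ ε ∧ ∃ᶠ n in atTop, C ≤ spectralRadius ℂ (u n + w) := by
  classical
  let S := {q : B × Finset ℕ //
    C < spectralRadius ℂ (x + q.1) ∧ ∀ n ∈ q.2, C < spectralRadius ℂ (u n + q.1)}
  have step : ∀ (k : ℕ) (q : S), ∃ q' : S, ‖q'.1.1 - q.1.1‖ ≤ ε / 2 / 2 ^ k ∧
      q.1.2 ⊆ q'.1.2 ∧ ∃ n ∈ q'.1.2, k ≤ n := by
    rintro k ⟨⟨s, F⟩, hs, hF⟩
    simp only at hs hF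
    let p : Option (Option F) → B
      | none => x + s
      | some none => x + s
      | some (some n) => u n + s
    let a : Option (Option F) → ℂ
      | none => 0
      | some none => 1
      | some (some _) => 0
    obtain ⟨C', hCC', hC'⟩ : ∃ C' : ℝ≥0, C < C' ∧ ∀ i, (C' : ℝ≥0∞) < spectralRadius ℂ (p i) := by
      have hp : ∀ i, (C : ℝ≥0∞) < spectralRadius ℂ (p i) := by
        rintro (_ | _ | n)
        exacts [hs, hs, hF n n.2]
      have : ∀ᶠ t : ℝ≥0 in 𝓝[>] C, ∀ i, (t : ℝ≥0∞) < spectralRadius ℂ (p i) :=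
        eventually_all.2 fun i =>
          (ENNReal.continuous_coe.continuousAt.eventually_lt_const (hp i)).filter_mono
            nhdsWithin_le_nhds
      exact (eventually_mem_nhdsWithin.and this).exists
    obtain ⟨δ, hδ, H⟩ := exists_common_translate_le_spectralRadius p a
      (by rintro (_ | _ | n) <;> simp [a]) hC' (ε := ε / 2 / 2 ^ k) (by positivity)
    obtain ⟨n, hn, hkn⟩ := ((Metric.tendsto_nhds.1 hu δ hδ).and (eventually_ge_atTop k)).exists
    obtain ⟨z, hz, hz'⟩ := H (x - u n) (by rwa [← dist_eq_norm, dist_comm])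
    have hlt : ∀ i, C < spectralRadius ℂ (p i + (z - a i) • (x - u n)) :=
      fun i => (ENNReal.coe_lt_coe.2 hCC').trans_le (hz' i)
    refine ⟨⟨⟨s + z • (x - u n), insert n F⟩, ?_, ?_⟩, by simpa using hz,
      Finset.subset_insert _ _, n, Finset.mem_insert_self _ _, hkn⟩
    · have := hlt none
      simpa [p, a, add_assoc] using this
    · intro m hm
      rcases Finset.mem_insert.1 hm with rfl | hm
      · have := hlt (some none)
        have e : x + s + (z - 1) • (x - u m) = u m + (s + z • (x - u m)) := by
          rw [sub_smul, one_smul]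
          abel
        simp only [p, a, e] at this
        exact this
      · have := hlt (some (some ⟨m, hm⟩))
        simpa [p, a, add_assoc] using this
  choose next hdist hsub hnew using step
  let q : ℕ → S := fun k => Nat.rec ⟨⟨0, ∅⟩, by simpa using hC, by simp⟩ next k
  have hq : ∀ k, q (k + 1) = next k (q k) := fun _ => rfl
  have hd : ∀ k, dist (q k).1.1 (q (k + 1)).1.1 ≤ ε / 2 / 2 ^ k := by
    intro k
    rw [dist_comm, dist_eq_norm, hq]
    exact hdist k (q k)
  obtain ⟨w, hw⟩ := cauchySeq_tendsto_of_complete (cauchySeq_of_le_geometric_two hd)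
  have hmono : Monotone fun k => (q k).1.2 := monotone_nat_of_le_succ fun k => by
    rw [hq]
    exact hsub k (q k)
  refine ⟨w, ?_, frequently_atTop.2 fun k => ?_⟩
  · have := dist_le_of_le_geometric_two_of_tendsto₀ hd hw
    simpa [q, dist_eq_norm] using this
  · obtain ⟨n, hn, hkn⟩ := hnew k (q k)
    refine ⟨n, hkn, le_spectralRadius_of_tendsto (hw.const_add (u n)) ?_⟩
    refine (eventually_atTop.2 ⟨k + 1, fun l hl => ?_⟩).frequently
    exact ((q l).2.2 n (hmono hl hn)).le

end Perturbation

theorem spectralRadius_neg {A : Type*} [NormedRing A] [NormedAlgebra ℂ A] (x : A) :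
    spectralRadius ℂ (-x) = spectralRadius ℂ x := by
  simp only [spectralRadius, ← spectrum.neg_eq]
  refine le_antisymm (iSup₂_le fun k hk => ?_) (iSup₂_le fun k hk => ?_)
  · exact le_iSup₂_of_le (-k) (by simpa using hk) (by simp)
  · exact le_iSup₂_of_le (-k) (by simpa using hk) (by simp)

theorem eq_zero_of_sub_algebraMap_mem {A : Type*} [NormedRing A] [NormedAlgebra ℂ A]
    {L : Ideal A} (hL : L ≠ ⊤) {k : A} {t : ℂ}
    (hk : spectralRadius ℂ k = 0) (h : k - algebraMap ℂ A t ∈ L) : t = 0 := by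
  by_contra ht
  have hres := spectrum.mem_resolventSet_of_spectralRadius_lt (𝕜 := ℂ) (a := k) (k := t) (by
    rw [hk]
    simpa using ht)
  refine hL (Ideal.eq_top_of_isUnit_mem _ h ?_)
  rw [← neg_sub]
  exact IsUnit.neg hres

section Radical

variable {A : Type*} [NormedRing A] [NormedAlgebra ℂ A] [CompleteSpace A]

/-- A left ideal `L` that is maximal and mapped into itself by right multiplication by a
quasinilpotent element contains that element. -/
theorem mem_of_isMaximal_of_mul_mem {L : Ideal A} (hL : L.IsMaximal) {a : A}
    (ha : spectralRadius ℂ a = 0) (h : ∀ l ∈ L, l * a ∈ L) : a ∈ L := by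
  by_contra haL
  obtain ⟨v, l, hl, hv⟩ : ∃ v, ∃ l ∈ L, v * a + l = 1 := by
    have := hL.exists_inv haL
    obtain ⟨y, i, hi, e⟩ := this
    exact ⟨y, i, hi, e⟩
  have key : ∀ n : ℕ, 1 - v ^ n * a ^ n ∈ L := by
    intro n
    induction n with
    | zero => simp
    | succ n ih =>
      have e : 1 - v ^ (n + 1) * a ^ (n + 1) = v * ((1 - v ^ n * a ^ n) * a) + l := by
        have e' : v * ((1 - v ^ n * a ^ n) * a) = v * a - v ^ (n + 1) * a ^ (n + 1) := by
          rw [pow_succ' v, pow_succ a]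
          noncomm_ring
        rw [e', ← hv]
        abel
      rw [e]
      exact L.add_mem (L.mul_mem_left _ (h _ ih)) hl
  have hge : ∀ n : ℕ, 1 ≤ ‖v ^ n * a ^ n‖ := by
    intro n
    by_contra! hlt
    exact hL.ne_top (Ideal.eq_top_of_isUnit_mem _ (key n) (isUnit_one_sub_of_norm_lt_one hlt))
  have hlt : spectralRadius ℂ a < ((‖v‖₊ + 1)⁻¹ : ℝ≥0) := by
    rw [ha]
    exact_mod_cast inv_pos.2 (by positivity)
  obtain ⟨n, hn, hn0⟩ :=
    ((eventually_norm_pow_lt_of_spectralRadius_lt hlt).and (eventually_gt_atTop 0)).exists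
  have h1 : ‖v ^ n * a ^ n‖ < 1 := by
    have hv1 : ‖v ^ n‖ ≤ (‖v‖ + 1) ^ n :=
      (norm_pow_le' v hn0).trans (pow_le_pow_left₀ (norm_nonneg _) (by linarith) n)
    have hpos : 0 < (‖v‖ + 1) ^ n := by positivity
    calc ‖v ^ n * a ^ n‖ ≤ ‖v ^ n‖ * ‖a ^ n‖ := norm_mul_le _ _
      _ ≤ (‖v‖ + 1) ^ n * ‖a ^ n‖ := by gcongr
      _ < (‖v‖ + 1) ^ n * ((‖v‖ + 1)⁻¹) ^ n := by
        gcongr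
        simpa using hn
      _ = 1 := by rw [← mul_pow, mul_inv_cancel₀ (by positivity), one_pow]
  exact (hge n).not_gt h1

/-- An element whose addition never increases the spectral radius lies in the radical. -/
theorem mem_jacobson_of_spectralRadius_add_le {a : A}
    (h : ∀ z : A, spectralRadius ℂ (z + a) ≤ spectralRadius ℂ z) :
    a ∈ Ideal.jacobson (⊥ : Ideal A) := by
  have ha : spectralRadius ℂ a = 0 := by simpa using h 0
  rw [Ideal.jacobson, Ideal.mem_sInf]
  rintro L ⟨-, hL⟩
  refine mem_of_isMaximal_of_mul_mem hL ha fun l hl => ?_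
  by_contra hla
  obtain ⟨y, l', hl', e⟩ := hL.exists_inv hla
  set u := y * l with hu
  have huL : u ∈ L := L.mul_mem_left _ hl
  obtain ⟨t, ht0, htu⟩ : ∃ t : ℂ, t ≠ 0 ∧ ‖t • u‖ < 1 := by
    have hc : Continuous fun t : ℂ => ‖t • u‖ := by fun_prop
    have := (hc.tendsto 0).eventually_lt_const (u := 1) (by simp)
    exact (eventually_mem_nhdsWithin.and (this.filter_mono (nhdsWithin_le_nhds (s := {0}ᶜ)))).exists
  obtain ⟨g, hg⟩ := isUnit_one_sub_of_norm_lt_one (x := -(t • u)) (by simpa using htu)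
  rw [sub_neg_eq_add] at hg
  set k : A := g * a * (↑g⁻¹ : A) - a with hk
  have hk0 : spectralRadius ℂ k = 0 := by
    have h1 := h (-(g * a * (↑g⁻¹ : A)))
    have e1 : -(g * a * (↑g⁻¹ : A)) + a = -k := by rw [hk]; abel
    rw [e1, spectralRadius_neg, spectralRadius_neg] at h1
    have h2 : spectralRadius ℂ (g * a * (↑g⁻¹ : A)) = 0 := by
      rw [← ha]
      simp only [spectralRadius, spectrum.units_conjugate]
    exact le_zero_iff.1 (h1.trans h2.le)
  refine ht0 (eq_zero_of_sub_algebraMap_mem hL.ne_top hk0 ?_)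
  have hkg : k * g = t • u * a - a * (t • u) := by
    rw [hk, sub_mul, Units.inv_mul_cancel_right, hg]
    noncomm_ring
  have e2 : k - algebraMap ℂ A t = -(t • (k * u)) - t • (a * u) - t • l' := by
    have e3 : k = k * g - t • (k * u) := by
      rw [hg, mul_add, mul_one, mul_smul_comm, add_sub_cancel_right]
    have e4 : u * a = 1 - l' := eq_sub_of_add_eq (by rw [hu, mul_assoc, e])
    calc k - algebraMap ℂ A t = k * g - t • (k * u) - t • 1 := by
          rw [← e3, Algebra.algebraMap_eq_smul_one]
      _ = -(t • (k * u)) - t • (a * u) - t • l' := by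
          rw [hkg, smul_mul_assoc, mul_smul_comm, e4, smul_sub]
          abel
  rw [e2]
  have hsm : ∀ x ∈ L, t • x ∈ L := fun x hx => L.smul_of_tower_mem t hx
  exact L.sub_mem (L.sub_mem (L.neg_mem (hsm _ (L.mul_mem_left _ huL)))
    (hsm _ (L.mul_mem_left _ huL))) (hsm _ hl')

end Radical

section Additive

variable {A B : Type*} [NormedRing A] [NormedAlgebra ℂ A] [CompleteSpace A]
  [NormedRing B] [NormedAlgebra ℂ B] [CompleteSpace B]

/-- Elements of the separating space of a surjective additive spectral radius preserving map never
increase the spectral radius. -/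
theorem spectralRadius_add_le_of_mem_separating (T : A →+ B) (hsurj : Function.Surjective T)
    (hr : ∀ x : A, spectralRadius ℂ (T x) = spectralRadius ℂ x) {x : ℕ → A} {b : B}
    (hx : Tendsto x atTop (𝓝 0)) (hb : Tendsto (fun n => T (x n)) atTop (𝓝 b)) (y : B) :
    spectralRadius ℂ (y + b) ≤ spectralRadius ℂ y := by
  refine le_of_forall_gt_imp_ge_of_dense fun C hC => ?_
  by_contra! hlt
  lift C to ℝ≥0 using hlt.ne_top
  obtain ⟨ε, hε, hball⟩ := Metric.isOpen_iff.1 (isOpen_setOf_spectralRadius_lt (A := B) C) y hC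
  obtain ⟨w, hw, hfreq⟩ := exists_translate_frequently_le_spectralRadius (hb.const_add y) hlt
    (half_pos hε)
  obtain ⟨z, hz⟩ := hsurj (y + w)
  have h1 : spectralRadius ℂ (y + w) < C := hball (by
    rw [Metric.mem_ball, dist_self_add_left]
    linarith)
  rw [← hz, hr] at h1
  refine h1.not_ge (le_spectralRadius_of_tendsto (u := fun n => z + x n)
    (by simpa using hx.const_add z) (hfreq.mono fun n hn => ?_))
  have e : y + T (x n) + w = T (z + x n) := by
    rw [map_add, hz]
    abel
  rwa [e, hr] at hn

theorem eq_zero_of_mem_separating (hA : Ideal.jacobson (⊥ : Ideal A) = ⊥) (T : A →+ B)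
    (hsurj : Function.Surjective T)
    (hr : ∀ x : A, spectralRadius ℂ (T x) = spectralRadius ℂ x) {x : ℕ → A} {b : B}
    (hx : Tendsto x atTop (𝓝 0)) (hb : Tendsto (fun n => T (x n)) atTop (𝓝 b)) : b = 0 := by
  obtain ⟨a, rfl⟩ := hsurj b
  have ha : a ∈ Ideal.jacobson (⊥ : Ideal A) := mem_jacobson_of_spectralRadius_add_le fun z => by
    rw [← hr, map_add, ← hr z]
    exact spectralRadius_add_le_of_mem_separating T hsurj hr hx hb (T z)
  rw [hA, Ideal.mem_bot] at ha
  rw [ha, map_zero]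

end Additive

/-- An additive map between real Banach spaces with trivial separating space is continuous. -/
theorem AddMonoidHom.continuous_of_separating_eq_zero {E F : Type*} [NormedAddCommGroup E]
    [NormedSpace ℝ E] [CompleteSpace E] [NormedAddCommGroup F] [NormedSpace ℝ F] [CompleteSpace F]
    (T : E →+ F) (h : ∀ (x : ℕ → E) (b : F), Tendsto x atTop (𝓝 0) →
      Tendsto (fun n => T (x n)) atTop (𝓝 b) → b = 0) : Continuous T := by
  have hsmul : ∀ (t : ℝ) (v : E), T (t • v) = t • T v := by
    intro t v
    obtain ⟨q, hq⟩ : ∃ q : ℕ → ℚ, Tendsto (fun n => (q n : ℝ)) atTop (𝓝 t) := by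
      obtain ⟨s, hs, hst⟩ := mem_closure_iff_seq_limit.1 (Rat.denseRange_cast (𝕜 := ℝ) t)
      choose q hq using hs
      exact ⟨q, by simpa only [hq] using hst⟩
    refine sub_eq_zero.1 (h (fun n => t • v - (q n : ℝ) • v) _ ?_ ?_)
    · simpa using (hq.smul_const v).const_sub (t • v)
    · have e : ∀ n, T (t • v - (q n : ℝ) • v) = T (t • v) - (q n : ℝ) • T v := fun n => by
        rw [map_sub, map_ratCast_smul T ℝ ℝ]
      simp only [e]
      exact (hq.smul_const (T v)).const_sub _
  let L : E →ₗ[ℝ] F := { T with map_smul' := hsmul }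
  refine L.continuous_of_seq_closed_graph fun u x y hu hy => sub_eq_zero.1 ?_
  refine h (fun n => u n - x) _ (by simpa using hu.sub_const x) ?_
  simp only [map_sub]
  exact hy.sub_const (T x)

/-- A surjective additive spectral-radius preserving map from a semisimple complex
unital Banach algebra onto a complex unital Banach algebra is continuous. -/
theorem continuous_of_additive_spectralRadius_preserving_domain_semisimple
    {A B : Type*} [NormedRing A] [NormedAlgebra ℂ A] [CompleteSpace A]
    [NormedRing B] [NormedAlgebra ℂ B] [CompleteSpace B]
    (hA : Ideal.jacobson (⊥ : Ideal A) = ⊥)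
    (T : A → B)
    (hsurj : Function.Surjective T)
    (hadd : ∀ x y : A, T (x + y) = T x + T y)
    (hr : ∀ x : A, spectralRadius ℂ (T x) = spectralRadius ℂ x) :
    Continuous T :=
  (AddMonoidHom.mk' T hadd).continuous_of_separating_eq_zero fun _ _ hx hb =>
    eq_zero_of_mem_separating hA (AddMonoidHom.mk' T hadd) hsurj hr hx hb
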